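/- arXiv:2208.08396 — 9 statements merged into one kernel-verified Lean document; each statement's English description precedes it below -/
import Mathlib

section
/- If h ∈ ℋ_𝐢 and 1 ≤ k < l ≤ N satisfy i_k = i_l, then σ_k(h) = σ_l(h); that is, for an element of ℋ_𝐢 the quantities σ_k take the same value at all positions of a given color. -/
/-- `σ_k(x) = x_k + Σ_{j<k} a_{i_k i_j} x_j` on the cellular crystal `𝔹_𝐢 ≅ ℤ^N`. -/
def sig {n N : ℕ} (A : Fin n → Fin n → ℤ) (ii : Fin N → Fin n)
    (x : Fin N → ℤ) (k : Fin N) : ℤ :=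
  x k + ∑ j ∈ Finset.univ.filter (fun j => j < k), A (ii k) (ii j) * x j

/-- `l = k⁺`: the least index `l > k` with the same color `i_l = i_k`. -/
def IsKPlus {n N : ℕ} (ii : Fin N → Fin n) (k l : Fin N) : Prop :=
  k < l ∧ ii l = ii k ∧ ∀ j : Fin N, k < j → ii j = ii k → l ≤ j

/-- `β_k(x) = x_k + Σ_{k<j<k⁺} a_{i_k i_j} x_j + x_{k⁺}` (with `l = k⁺`). -/
def betaFn {n N : ℕ} (A : Fin n → Fin n → ℤ) (ii : Fin N → Fin n)
    (x : Fin N → ℤ) (k l : Fin N) : ℤ :=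
  x k + ∑ j ∈ Finset.univ.filter (fun j => k < j ∧ j < l), A (ii k) (ii j) * x j + x l

/-- `ℋ_𝐢 = {h ∈ ℤ^N : β_k(h) = 0 whenever k⁺ exists}`. -/
def Hset {n N : ℕ} (A : Fin n → Fin n → ℤ) (ii : Fin N → Fin n) : Set (Fin N → ℤ) :=
  {h | ∀ k l : Fin N, IsKPlus ii k l → betaFn A ii h k l = 0}

/-- The set of positions of color `i` in the word `𝐢`. -/
def occ {n N : ℕ} (ii : Fin N → Fin n) (i : Fin n) : Finset (Fin N) :=
  Finset.univ.filter (fun k => ii k = i)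

/-- `σ̃_i(x) = max{σ_k(x) : i_k = i}` (junk value `0` if `i` does not occur in `𝐢`). -/
def sigTilde {n N : ℕ} (A : Fin n → Fin n → ℤ) (ii : Fin N → Fin n)
    (i : Fin n) (x : Fin N → ℤ) : ℤ :=
  if h : (occ ii i).Nonempty then (occ ii i).sup' h (sig A ii x) else 0

/-- The set of positions `k` of color `i` where `σ_k(x)` attains the maximum `σ̃_i(x)`. -/
def Mset {n N : ℕ} (A : Fin n → Fin n → ℤ) (ii : Fin N → Fin n)
    (i : Fin n) (x : Fin N → ℤ) : Finset (Fin N) :=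
  (occ ii i).filter (fun k => sig A ii x k = sigTilde A ii i x)

/-- The Kashiwara operator `f̃_i` on `𝔹_𝐢 ≅ ℤ^N`: add `1` at position `m̃ᶠ_i(x)`,
the largest maximizer of `σ` among positions of color `i`. -/
def ftilde {n N : ℕ} (A : Fin n → Fin n → ℤ) (ii : Fin N → Fin n)
    (i : Fin n) (x : Fin N → ℤ) : Fin N → ℤ :=
  if h : (Mset A ii i x).Nonempty then
    Function.update x ((Mset A ii i x).max' h) (x ((Mset A ii i x).max' h) + 1)
  else x

/-- The Kashiwara operator `ẽ_i` on `𝔹_𝐢 ≅ ℤ^N`: subtract `1` at position `m̃ᵉ_i(x)`,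
the smallest maximizer of `σ` among positions of color `i`. -/
def etilde {n N : ℕ} (A : Fin n → Fin n → ℤ) (ii : Fin N → Fin n)
    (i : Fin n) (x : Fin N → ℤ) : Fin N → ℤ :=
  if h : (Mset A ii i x).Nonempty then
    Function.update x ((Mset A ii i x).min' h) (x ((Mset A ii i x).min' h) - 1)
  else x

/-- If `l = k⁺`, then `σ_l(x) - σ_k(x) = β_k(x)`. -/
theorem sig_sub_sig_eq_betaFn {n N : ℕ} (A : Fin n → Fin n → ℤ) (hA2 : ∀ p, A p p = 2)
    (ii : Fin N → Fin n) (x : Fin N → ℤ) {k l : Fin N} (hkl : k < l) (hcol : ii l = ii k) :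
    sig A ii x l - sig A ii x k = betaFn A ii x k l := by
  have hsplit : Finset.univ.filter (fun j => j < l) =
      (Finset.univ.filter (fun j => j < k)) ∪
        insert k (Finset.univ.filter (fun j => k < j ∧ j < l)) := by
    ext j
    simp only [Finset.mem_filter, Finset.mem_univ, true_and, Finset.mem_union, Finset.mem_insert]
    grind
  have hdisj : Disjoint (Finset.univ.filter (fun j => j < k))
      (insert k (Finset.univ.filter (fun j => k < j ∧ j < l))) := by
    rw [Finset.disjoint_left]
    intro j
    simp only [Finset.mem_filter, Finset.mem_univ, true_and, Finset.mem_insert]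
    grind
  unfold sig betaFn
  rw [hsplit, Finset.sum_union hdisj, Finset.sum_insert (by simp), hcol, hA2]
  ring

/-- A position with an earlier position `k` of the same color is `p⁺` for some `p ≥ k`. -/
theorem exists_isKPlus {n N : ℕ} (ii : Fin N → Fin n) {k l : Fin N} (hkl : k < l)
    (hcol : ii k = ii l) : ∃ p, k ≤ p ∧ IsKPlus ii p l := by
  obtain ⟨p, hkp, hp⟩ := (Set.toFinite {j : Fin N | j < l ∧ ii j = ii l}).exists_le_maximal
    (show k ∈ {j : Fin N | j < l ∧ ii j = ii l} from ⟨hkl, hcol⟩)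
  refine ⟨p, hkp, hp.prop.1, hp.prop.2.symm, fun j hpj hj => ?_⟩
  by_contra! hjl
  exact hpj.not_ge (hp.le_of_ge ⟨hjl, hj.trans hp.prop.2⟩ hpj.le)

/-- for `h ∈ ℋ_𝐢` and positions `k < l` of the same color `i_k = i_l`,
one has `σ_k(h) = σ_l(h)`. -/
theorem sig_const_on_Hset
    (n N : ℕ) (hn : 1 ≤ n) (hN : 1 ≤ N)
    (A : Fin n → Fin n → ℤ)
    (hA2 : ∀ p, A p p = 2)
    (hAle : ∀ p q, p ≠ q → A p q ≤ 0)
    (hAzero : ∀ p q, A p q = 0 ↔ A q p = 0)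
    (ii : Fin N → Fin n) (h : Fin N → ℤ) (hH : h ∈ Hset A ii)
    (k l : Fin N) (hkl : k < l) (hcol : ii k = ii l) :
    sig A ii h k = sig A ii h l := by
  induction l using WellFoundedLT.induction with
  | ind l ih =>
    obtain ⟨p, hkp, hp⟩ := exists_isKPlus ii hkl hcol
    have hpl : sig A ii h p = sig A ii h l := by
      have := sig_sub_sig_eq_betaFn A hA2 ii h hp.1 hp.2.1
      rw [hH p l hp] at this
      linarith
    rcases hkp.eq_or_lt with rfl | hlt
    · exact hpl
    · exact (ih p hp.1 hlt (hcol.trans hp.2.1)).trans hpl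
end

section
/- For every h ∈ ℋ_𝐢, every x ∈ ℤ^N and every i ∈ I occurring in 𝐢, the indices at which the Kashiwara operators act are unchanged by translation by h: m̃ᵉ_i(x + h) = m̃ᵉ_i(x) and m̃ᶠ_i(x + h) = m̃ᶠ_i(x). -/
/-- The map `x ↦ σ_k(x)` is additive. -/
theorem sig_add {n N : ℕ} (A : Fin n → Fin n → ℤ) (ii : Fin N → Fin n)
    (x y : Fin N → ℤ) (k : Fin N) : sig A ii (x + y) k = sig A ii x k + sig A ii y k := by
  simp only [sig, Pi.add_apply, mul_add, Finset.sum_add_distrib]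
  ring

/-- For two positions `k < l` of the same color, `σ_l - σ_k` is the `β`-expression of `k, l`. -/
theorem sig_eq_sig_add_betaFn {n N : ℕ} {A : Fin n → Fin n → ℤ} (hA2 : ∀ p, A p p = 2)
    {ii : Fin N → Fin n} (x : Fin N → ℤ) {k l : Fin N} (hkl : k < l) (hc : ii l = ii k) :
    sig A ii x l = sig A ii x k + betaFn A ii x k l := by
  have hsplit : Finset.univ.filter (fun j => j < l) =
      Finset.univ.filter (fun j => j < k) ∪
        insert k (Finset.univ.filter (fun j => k < j ∧ j < l)) := by
    ext j
    simp only [Finset.mem_filter, Finset.mem_union, Finset.mem_insert, Finset.mem_univ, true_and]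
    grind
  have hdisj : Disjoint (Finset.univ.filter (fun j => j < k))
      (insert k (Finset.univ.filter (fun j => k < j ∧ j < l))) := by
    rw [Finset.disjoint_left]
    intro j
    simp only [Finset.mem_filter, Finset.mem_insert, Finset.mem_univ, true_and]
    grind
  simp only [sig, betaFn, hc]
  rw [hsplit, Finset.sum_union hdisj, Finset.sum_insert (by simp), hA2]
  ring

/-- For `h ∈ ℋ_𝐢`, the value `σ_k(h)` only depends on the color of `k`. -/
theorem sig_eq_of_mem_Hset {n N : ℕ} {A : Fin n → Fin n → ℤ} (hA2 : ∀ p, A p p = 2)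
    {ii : Fin N → Fin n} {h : Fin N → ℤ} (hH : h ∈ Hset A ii) {k l : Fin N}
    (hc : ii l = ii k) : sig A ii h l = sig A ii h k := by
  have of_lt : ∀ l k : Fin N, k < l → ii l = ii k → sig A ii h l = sig A ii h k := by
    intro l
    induction l using WellFoundedLT.induction with
    | ind l ih =>
      intro k hkl hc
      have hne : (Finset.univ.filter (fun j => j < l ∧ ii j = ii l)).Nonempty :=
        ⟨k, by simp [hkl, hc]⟩
      obtain ⟨m, hm, hmax⟩ := Finset.exists_max_image _ id hne
      simp only [Finset.mem_filter, Finset.mem_univ, true_and, id] at hm hmax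
      have hplus : IsKPlus ii m l :=
        ⟨hm.1, hm.2.symm, fun j hmj hj =>
          not_lt.mp fun hjl => absurd (hmax j ⟨hjl, hj.trans hm.2⟩) (not_le.mpr hmj)⟩
      have hlm : sig A ii h l = sig A ii h m := by
        rw [sig_eq_sig_add_betaFn hA2 h hm.1 hm.2.symm, hH m l hplus, add_zero]
      rcases (hmax k ⟨hkl, hc.symm⟩).eq_or_lt with rfl | hkm
      · exact hlm
      · exact hlm.trans (ih m hm.1 k hkm (hm.2.trans hc))
  rcases lt_trichotomy k l with hkl | rfl | hlk
  · exact of_lt l k hkl hc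
  · rfl
  · exact (of_lt k l hlk hc.symm).symm

/-- The maximizers are the positions of color `i` whose `σ` dominates all others. -/
theorem mem_Mset_iff {n N : ℕ} {A : Fin n → Fin n → ℤ} {ii : Fin N → Fin n} {i : Fin n}
    {x : Fin N → ℤ} {k : Fin N} :
    k ∈ Mset A ii i x ↔ ii k = i ∧ ∀ j, ii j = i → sig A ii x j ≤ sig A ii x k := by
  simp only [Mset, occ, Finset.mem_filter, Finset.mem_univ, true_and]
  refine and_congr_right fun hk => ?_
  have hmem : k ∈ occ ii i := by simp [occ, hk]
  have hne : (occ ii i).Nonempty := ⟨k, hmem⟩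
  rw [sigTilde, dif_pos hne,
    le_antisymm_iff, and_iff_right (Finset.le_sup' (sig A ii x) hmem), Finset.sup'_le_iff]
  simp [occ]

/-- Translation by an element of `ℋ_𝐢` does not change the set of maximizers. -/
theorem Mset_add_of_mem_Hset {n N : ℕ} {A : Fin n → Fin n → ℤ} (hA2 : ∀ p, A p p = 2)
    {ii : Fin N → Fin n} {h : Fin N → ℤ} (hH : h ∈ Hset A ii) (x : Fin N → ℤ) (i : Fin n) :
    Mset A ii i (x + h) = Mset A ii i x := by
  ext k
  rw [mem_Mset_iff, mem_Mset_iff]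
  refine and_congr_right fun hk => forall₂_congr fun j hj => ?_
  rw [sig_add, sig_add, sig_eq_of_mem_Hset hA2 hH (hj.trans hk.symm), add_le_add_iff_right]

/-- for `h ∈ ℋ_𝐢`, `x ∈ ℤ^N` and a color `i` occurring in `𝐢`, the indices
at which the Kashiwara operators act are unchanged by translation by `h`:
`m̃ᵉ_i(x + h) = m̃ᵉ_i(x)` and `m̃ᶠ_i(x + h) = m̃ᶠ_i(x)`.  Here `m̃ᵉ_i` (resp. `m̃ᶠ_i`) is
the smallest (resp. largest) element of the set of maximizers `Mset`, expressed via
`Finset.min` (resp. `Finset.max`). -/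
theorem me_mf_add_Hset
    (n N : ℕ) (hn : 1 ≤ n) (hN : 1 ≤ N)
    (A : Fin n → Fin n → ℤ)
    (hA2 : ∀ p, A p p = 2)
    (hAle : ∀ p q, p ≠ q → A p q ≤ 0)
    (hAzero : ∀ p q, A p q = 0 ↔ A q p = 0)
    (ii : Fin N → Fin n) (h : Fin N → ℤ) (hH : h ∈ Hset A ii)
    (x : Fin N → ℤ) (i : Fin n) (hocc : ∃ k, ii k = i) :
    (Mset A ii i (x + h)).min = (Mset A ii i x).min ∧
    (Mset A ii i (x + h)).max = (Mset A ii i x).max := by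
  rw [Mset_add_of_mem_Hset hA2 hH]
  exact ⟨rfl, rfl⟩
end

section
/- For every i ∈ I occurring in 𝐢 and every x ∈ ℤ^N, the Kashiwara operators on the cellular crystal are mutually inverse bijections of ℤ^N: ẽ_i(f̃_i(x)) = x and f̃_i(ẽ_i(x)) = x. -/
theorem mem_occ {n N : ℕ} {ii : Fin N → Fin n} {i : Fin n} {k : Fin N} :
    k ∈ occ ii i ↔ ii k = i := by
  simp [occ]

/-- Membership in `Mset` means maximizing `σ` among the positions of color `i`. -/
theorem mem_Mset {n N : ℕ} {A : Fin n → Fin n → ℤ} {ii : Fin N → Fin n} {i : Fin n}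
    {x : Fin N → ℤ} {m : Fin N} :
    m ∈ Mset A ii i x ↔ ii m = i ∧ ∀ k, ii k = i → sig A ii x k ≤ sig A ii x m := by
  rw [Mset, Finset.mem_filter, mem_occ]
  refine and_congr_right fun hm => ?_
  have hne : (occ ii i).Nonempty := ⟨m, mem_occ.2 hm⟩
  rw [sigTilde, dif_pos hne]
  constructor
  · intro h k hk
    rw [h]
    exact Finset.le_sup' _ (mem_occ.2 hk)
  · intro h
    exact le_antisymm (Finset.le_sup' _ (mem_occ.2 hm))
      (Finset.sup'_le _ _ fun k hk => h k (mem_occ.1 hk))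

theorem Mset_nonempty {n N : ℕ} (A : Fin n → Fin n → ℤ) {ii : Fin N → Fin n} {i : Fin n}
    (hocc : ∃ k, ii k = i) (x : Fin N → ℤ) : (Mset A ii i x).Nonempty := by
  obtain ⟨k, hk⟩ := hocc
  obtain ⟨m, hm, hmax⟩ := Finset.exists_max_image (occ ii i) (sig A ii x) ⟨k, mem_occ.2 hk⟩
  exact ⟨m, mem_Mset.2 ⟨mem_occ.1 hm, fun k hk => hmax k (mem_occ.2 hk)⟩⟩

theorem ftilde_eq_update {n N : ℕ} {A : Fin n → Fin n → ℤ} {ii : Fin N → Fin n} {i : Fin n}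
    {x : Fin N → ℤ} {m : Fin N} (hm : IsGreatest (Mset A ii i x : Set (Fin N)) m) :
    ftilde A ii i x = Function.update x m (x m + 1) := by
  have hne : (Mset A ii i x).Nonempty := ⟨m, hm.1⟩
  rw [ftilde, dif_pos hne, (Finset.isGreatest_max' _ hne).unique hm]

theorem etilde_eq_update {n N : ℕ} {A : Fin n → Fin n → ℤ} {ii : Fin N → Fin n} {i : Fin n}
    {x : Fin N → ℤ} {m : Fin N} (hm : IsLeast (Mset A ii i x : Set (Fin N)) m) :
    etilde A ii i x = Function.update x m (x m - 1) := by
  have hne : (Mset A ii i x).Nonempty := ⟨m, hm.1⟩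
  rw [etilde, dif_pos hne, (Finset.isLeast_min' _ hne).unique hm]

/-- The effect on `σ_k` of adding `c` to the coordinate at position `m`. -/
theorem sig_update_add {n N : ℕ} (A : Fin n → Fin n → ℤ) (ii : Fin N → Fin n)
    (x : Fin N → ℤ) (m k : Fin N) (c : ℤ) :
    sig A ii (Function.update x m (x m + c)) k =
      sig A ii x k + (if k = m then c else 0) + (if m < k then A (ii k) (ii m) * c else 0) := by
  have hupd : ∀ j, Function.update x m (x m + c) j = x j + if j = m then c else 0 := by
    intro j
    by_cases h : j = m
    · subst h; simp
    · simp [h]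
  simp only [sig, hupd, mul_add, Finset.sum_add_distrib, mul_ite, mul_zero,
    Finset.sum_ite_eq', Finset.mem_filter, Finset.mem_univ, true_and]
  ring

/-- The positions of color `i` shift by `2c` to the right of `m`, by `c` at `m`, and are fixed
to the left of `m`. -/
theorem sig_update_add_of_color {n N : ℕ} {A : Fin n → Fin n → ℤ} (hA2 : ∀ p, A p p = 2)
    {ii : Fin N → Fin n} {m k : Fin N} (hk : ii k = ii m) (x : Fin N → ℤ) (c : ℤ) :
    sig A ii (Function.update x m (x m + c)) k =
      sig A ii x k + (if k = m then c else 0) + (if m < k then 2 * c else 0) := by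
  rw [sig_update_add, hk, hA2]

/-- The last maximizer for `x` is the first maximizer once its coordinate is raised by `1`. -/
theorem isLeast_Mset_update {n N : ℕ} {A : Fin n → Fin n → ℤ} (hA2 : ∀ p, A p p = 2)
    {ii : Fin N → Fin n} {i : Fin n} {x : Fin N → ℤ} {m : Fin N}
    (hm : IsGreatest (Mset A ii i x : Set (Fin N)) m) :
    IsLeast (Mset A ii i (Function.update x m (x m + 1)) : Set (Fin N)) m := by
  obtain ⟨hmem, hub⟩ := hm
  obtain ⟨rfl, hmax⟩ := mem_Mset.1 (Finset.mem_coe.1 hmem)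
  have hlt : ∀ k, ii k = ii m → m < k → sig A ii x k < sig A ii x m := fun k hk hmk =>
    lt_of_not_ge fun hge => hmk.not_ge <| hub <| Finset.mem_coe.2 <|
      mem_Mset.2 ⟨hk, fun j hj => (hmax j hj).trans hge⟩
  refine ⟨Finset.mem_coe.2 (mem_Mset.2 ⟨rfl, fun k hk => ?_⟩), fun k hk => ?_⟩
  · rw [sig_update_add_of_color hA2 hk, sig_update_add_of_color hA2 rfl]
    have h₁ := hmax k hk
    have h₂ := hlt k hk
    grind
  · obtain ⟨hk, hkmax⟩ := mem_Mset.1 (Finset.mem_coe.1 hk)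
    have h₁ := hkmax m rfl
    rw [sig_update_add_of_color hA2 hk, sig_update_add_of_color hA2 rfl] at h₁
    have h₂ := hmax k hk
    grind

/-- The first maximizer for `x` is the last maximizer once its coordinate is lowered by `1`. -/
theorem isGreatest_Mset_update {n N : ℕ} {A : Fin n → Fin n → ℤ} (hA2 : ∀ p, A p p = 2)
    {ii : Fin N → Fin n} {i : Fin n} {x : Fin N → ℤ} {m : Fin N}
    (hm : IsLeast (Mset A ii i x : Set (Fin N)) m) :
    IsGreatest (Mset A ii i (Function.update x m (x m - 1)) : Set (Fin N)) m := by
  obtain ⟨hmem, hlb⟩ := hm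
  obtain ⟨rfl, hmax⟩ := mem_Mset.1 (Finset.mem_coe.1 hmem)
  have hlt : ∀ k, ii k = ii m → k < m → sig A ii x k < sig A ii x m := fun k hk hkm =>
    lt_of_not_ge fun hge => hkm.not_ge <| hlb <| Finset.mem_coe.2 <|
      mem_Mset.2 ⟨hk, fun j hj => (hmax j hj).trans hge⟩
  rw [sub_eq_add_neg]
  refine ⟨Finset.mem_coe.2 (mem_Mset.2 ⟨rfl, fun k hk => ?_⟩), fun k hk => ?_⟩
  · rw [sig_update_add_of_color hA2 hk, sig_update_add_of_color hA2 rfl]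
    have h₁ := hmax k hk
    have h₂ := hlt k hk
    grind
  · obtain ⟨hk, hkmax⟩ := mem_Mset.1 (Finset.mem_coe.1 hk)
    have h₁ := hkmax m rfl
    rw [sig_update_add_of_color hA2 hk, sig_update_add_of_color hA2 rfl] at h₁
    have h₂ := hmax k hk
    grind

/-- for every color `i` occurring in `𝐢` and every `x ∈ ℤ^N`, the Kashiwara
operators on the cellular crystal are mutually inverse: `ẽ_i(f̃_i x) = x` and
`f̃_i(ẽ_i x) = x`. -/
theorem etilde_ftilde_inverse
    (n N : ℕ) (hn : 1 ≤ n) (hN : 1 ≤ N)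
    (A : Fin n → Fin n → ℤ)
    (hA2 : ∀ p, A p p = 2)
    (hAle : ∀ p q, p ≠ q → A p q ≤ 0)
    (hAzero : ∀ p q, A p q = 0 ↔ A q p = 0)
    (ii : Fin N → Fin n) (i : Fin n) (hocc : ∃ k, ii k = i) (x : Fin N → ℤ) :
    etilde A ii i (ftilde A ii i x) = x ∧ ftilde A ii i (etilde A ii i x) = x := by
  have hne := Mset_nonempty A hocc x
  constructor
  · have hm := Finset.isGreatest_max' _ hne
    rw [ftilde_eq_update hm, etilde_eq_update (isLeast_Mset_update hA2 hm)]
    simp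
  · have hm := Finset.isLeast_min' _ hne
    rw [etilde_eq_update hm, ftilde_eq_update (isGreatest_Mset_update hA2 hm)]
    simp
end

section
/- (Local form of the 4-move identity on ℋ, Lemma on braid-type isomorphisms, case c_{ij} = 2.) Let c₁, c₂ be positive integers with c₁c₂ = 2. If integers x, y, z, w satisfy x − c₁y + z = 0 and y − c₂z + w = 0, then φ⁽²⁾(−x, −y, −z, −w) = (−w, −z, −y, −x); i.e. on solutions of the β-equations the braid-type isomorphism φ⁽²⁾ simply reverses the quadruple of coordinates. -/
/-- The braid-type isomorphism `φ⁽²⁾ : ℤ⁴ → ℤ⁴` (case `c_{ij} = 2`), with parameters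
`c₁, c₂`; here `t₊ = max t 0`. -/
def phi2 (c1 c2 : ℤ) (x y z w : ℤ) : ℤ × ℤ × ℤ × ℤ :=
  (w + max (-c2 * x + y - w + c2 * max (x - c1 * y + z) 0) 0,
   x + c1 * w + max (-x + z - c1 * w + max (x - c1 * y + z) 0) 0,
   y - max (-c2 * x + y - w + c2 * max (x - c1 * y + z) 0) 0,
   z - c1 * w - max (-x + z - c1 * w + max (x - c1 * y + z) 0) 0)

/-- local form of the 4-move identity on `ℋ`: for positive integers
`c₁, c₂` with `c₁c₂ = 2`, if `x − c₁y + z = 0` and `y − c₂z + w = 0`, then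
`φ⁽²⁾(−x, −y, −z, −w) = (−w, −z, −y, −x)`. -/
theorem phi2_reverses (c1 c2 : ℤ) (hc1 : 0 < c1) (hc2 : 0 < c2) (hc : c1 * c2 = 2)
    (x y z w : ℤ) (h1 : x - c1 * y + z = 0) (h2 : y - c2 * z + w = 0) :
    phi2 c1 c2 (-x) (-y) (-z) (-w) = (-w, -z, -y, -x) := by
  have e1 : -x - c1 * -y + -z = 0 := by linear_combination -h1
  have e2 : -c2 * -x + -y - -w = 0 := by linear_combination c2 * h1 + h2 + y * hc
  have e3 : - -x + -z - c1 * -w = 0 := by linear_combination h1 + c1 * h2 + z * hc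
  simp only [phi2, e1, e2, e3, max_self, mul_zero, add_zero, sub_zero, Prod.mk.injEq, true_and]
  constructor <;> linarith
end

section
/- (Local form of the 6-move identity on ℋ, Lemma on braid-type isomorphisms, case c_{ij} = 3.) Let c₁, c₂ be positive integers with c₁c₂ = 3. If integers x, y, z, u, v, w satisfy x − c₁y + z = 0, y − c₂z + u = 0, z − c₁u + v = 0 and u − c₂v + w = 0, then φ⁽³⁾(−x, −y, −z, −u, −v, −w) = (−w, −v, −u, −z, −y, −x); i.e. on solutions of the β-equations the braid-type isomorphism φ⁽³⁾ simply reverses the six coordinates. -/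
/-- The braid-type isomorphism `φ⁽³⁾ : ℤ⁶ → ℤ⁶` (case `c_{ij} = 3`), with parameters
`c₁, c₂`; here `t₊ = max t 0`.  With `A = −x + c₁y − z`, `B = −y + c₂z − u`,
`C = −z + c₁u − v`, `D = −u + c₂v − w` one sets
`X = w + (D + (c₂C + (2B + A₊)₊)₊)₊`, `Y = x + c₁w + (c₁D + (3C + (2c₁B + 2A₊)₊)₊)₊`,
`V = u − w − (2D + (2c₂C + (3B + c₂A₊)₊)₊)₊`,
`W = v − c₁w − (c₁D + (2C + (c₁B + A₊)₊)₊)₊`, `Z = y + u + w − X − V`,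
`U = x + z + v − Y − W`, and `φ⁽³⁾(x,y,z,u,v,w) = (X, Y, Z, U, V, W)`. -/
def phi3 (c1 c2 : ℤ) (x y z u v w : ℤ) : ℤ × ℤ × ℤ × ℤ × ℤ × ℤ :=
  let A := -x + c1 * y - z
  let B := -y + c2 * z - u
  let C := -z + c1 * u - v
  let D := -u + c2 * v - w
  let X := w + max (D + max (c2 * C + max (2 * B + max A 0) 0) 0) 0
  let Y := x + c1 * w + max (c1 * D + max (3 * C + max (2 * c1 * B + 2 * max A 0) 0) 0) 0
  let V := u - w - max (2 * D + max (2 * c2 * C + max (3 * B + c2 * max A 0) 0) 0) 0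
  let W := v - c1 * w - max (c1 * D + max (2 * C + max (c1 * B + max A 0) 0) 0) 0
  (X, Y, y + u + w - X - V, x + z + v - Y - W, V, W)

/-- local form of the 6-move identity on `ℋ`: for positive integers
`c₁, c₂` with `c₁c₂ = 3`, if `x − c₁y + z = 0`, `y − c₂z + u = 0`, `z − c₁u + v = 0`
and `u − c₂v + w = 0`, then `φ⁽³⁾(−x, −y, −z, −u, −v, −w) = (−w, −v, −u, −z, −y, −x)`. -/
theorem phi3_reverses (c1 c2 : ℤ) (hc1 : 0 < c1) (hc2 : 0 < c2) (hc : c1 * c2 = 3)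
    (x y z u v w : ℤ)
    (h1 : x - c1 * y + z = 0) (h2 : y - c2 * z + u = 0)
    (h3 : z - c1 * u + v = 0) (h4 : u - c2 * v + w = 0) :
    phi3 c1 c2 (-x) (-y) (-z) (-u) (-v) (-w) = (-w, -v, -u, -z, -y, -x) := by
  have hA : -(-x) + c1 * -y - -z = 0 := by linear_combination h1
  have hB : -(-y) + c2 * -z - -u = 0 := by linear_combination h2
  have hC : -(-z) + c1 * -u - -v = 0 := by linear_combination h3
  have hD : -(-u) + c2 * -v - -w = 0 := by linear_combination h4
  have hz : z = 2 * v - c1 * w := by linear_combination h3 + c1 * h4 + v * hc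
  have hy : y = u - w := by linear_combination h2 + h4 + c2 * hz - h4 * 3 - w * hc
  have hx : x = v - c1 * w := by linear_combination h1 - h3 + c1 * hy
  simp only [phi3, hA, hB, hC, hD, mul_zero, add_zero, max_self, sub_zero, Prod.mk.injEq]
  refine ⟨trivial, ?_, ?_, ?_, ?_, ?_⟩ <;> linarith
end

section
/- (Well-definedness of the 2-move on ℋ.) Suppose 1 ≤ m and m + 1 ≤ N, with i_m = i, i_{m+1} = j, i ≠ j, and a_{ij} = a_{ji} = 0. Let 𝐢′ be the word obtained from 𝐢 by replacing the block (i_m, i_{m+1}) = (i, j) by (j, i), and let T : ℤ^N → ℤ^N be the map swapping coordinates m and m + 1 and fixing all other coordinates. Then T restricts to a bijection from ℋ_𝐢 onto ℋ_{𝐢′}. -/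
/-- Transposing two consecutive positions preserves the order of every other pair of positions. -/
theorem swap_lt_swap_iff_of_succ {N : ℕ} {p q : Fin N} (hpq : (p : ℕ) + 1 = q) {a b : Fin N}
    (h₁ : ¬(a = p ∧ b = q)) (h₂ : ¬(a = q ∧ b = p)) :
    Equiv.swap p q a < Equiv.swap p q b ↔ a < b := by
  simp only [Equiv.swap_apply_def]
  split_ifs <;> simp only [Fin.lt_def, Fin.ext_iff] at * <;> omega

theorem IsKPlus.comp_swap {n N : ℕ} {ii : Fin N → Fin n} {p q : Fin N}
    (hpq : (p : ℕ) + 1 = q) (hne : ii p ≠ ii q) {k l : Fin N}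
    (h : IsKPlus (ii ∘ Equiv.swap p q) k l) :
    IsKPlus ii (Equiv.swap p q k) (Equiv.swap p q l) := by
  have key : ∀ a b : Fin N, ii (Equiv.swap p q a) = ii (Equiv.swap p q b) →
      (Equiv.swap p q a < Equiv.swap p q b ↔ a < b) := by
    intro a b hab
    apply swap_lt_swap_iff_of_succ hpq
    · rintro ⟨rfl, rfl⟩
      simp only [Equiv.swap_apply_left, Equiv.swap_apply_right] at hab
      exact hne hab.symm
    · rintro ⟨rfl, rfl⟩
      simp only [Equiv.swap_apply_left, Equiv.swap_apply_right] at hab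
      exact hne hab
  obtain ⟨hkl, hcol, hmin⟩ := h
  simp only [Function.comp_apply] at hcol hmin
  refine ⟨(key k l hcol.symm).2 hkl, hcol, fun c hkc hc => ?_⟩
  obtain ⟨c, rfl⟩ := (Equiv.swap p q).surjective c
  rw [← not_lt, key c l (hc.trans hcol.symm), not_lt]
  exact hmin c ((key k c hc.symm).1 hkc) hc

theorem betaFn_comp_swap {n N : ℕ} (A : Fin n → Fin n → ℤ) {ii : Fin N → Fin n} {p q : Fin N}
    (hpq : (p : ℕ) + 1 = q) (hA₁ : A (ii p) (ii q) = 0) (hA₂ : A (ii q) (ii p) = 0)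
    (x : Fin N → ℤ) {k l : Fin N}
    (hcol : ii (Equiv.swap p q l) = ii (Equiv.swap p q k)) :
    betaFn A (ii ∘ Equiv.swap p q) (x ∘ Equiv.swap p q) k l =
      betaFn A ii x (Equiv.swap p q k) (Equiv.swap p q l) := by
  unfold betaFn
  simp only [Function.comp_apply, Finset.sum_filter]
  congr 2
  refine Fintype.sum_equiv (Equiv.swap p q) _ _ fun c => ?_
  by_cases hz : A (ii (Equiv.swap p q k)) (ii (Equiv.swap p q c)) = 0
  · simp [hz]
  have hk₁ : ¬(k = p ∧ c = q) := by
    rintro ⟨rfl, rfl⟩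
    simp [hA₂] at hz
  have hk₂ : ¬(k = q ∧ c = p) := by
    rintro ⟨rfl, rfl⟩
    simp [hA₁] at hz
  rw [← hcol] at hz
  have hl₁ : ¬(c = p ∧ l = q) := by
    rintro ⟨rfl, rfl⟩
    simp [hA₁] at hz
  have hl₂ : ¬(c = q ∧ l = p) := by
    rintro ⟨rfl, rfl⟩
    simp [hA₂] at hz
  simp only [swap_lt_swap_iff_of_succ hpq hk₁ hk₂, swap_lt_swap_iff_of_succ hpq hl₁ hl₂]

theorem comp_swap_mem_Hset {n N : ℕ} {A : Fin n → Fin n → ℤ} {ii : Fin N → Fin n} {p q : Fin N}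
    (hpq : (p : ℕ) + 1 = q) (hne : ii p ≠ ii q)
    (hA₁ : A (ii p) (ii q) = 0) (hA₂ : A (ii q) (ii p) = 0)
    {h : Fin N → ℤ} (hh : h ∈ Hset A ii) :
    h ∘ Equiv.swap p q ∈ Hset A (ii ∘ Equiv.swap p q) := fun k l hkl => by
  rw [betaFn_comp_swap A hpq hA₁ hA₂ h hkl.2.1]
  exact hh _ _ (hkl.comp_swap hpq hne)

theorem bijOn_comp_swap_Hset {n N : ℕ} {A : Fin n → Fin n → ℤ} {ii : Fin N → Fin n} {p q : Fin N}
    (hpq : (p : ℕ) + 1 = q) (hne : ii p ≠ ii q)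
    (hA₁ : A (ii p) (ii q) = 0) (hA₂ : A (ii q) (ii p) = 0) :
    Set.BijOn (fun h : Fin N → ℤ => h ∘ Equiv.swap p q) (Hset A ii)
      (Hset A (ii ∘ Equiv.swap p q)) := by
  have hinv : ∀ {α : Type} (f : Fin N → α), (f ∘ Equiv.swap p q) ∘ Equiv.swap p q = f :=
    fun f => funext fun k => by simp
  refine Set.InvOn.bijOn (f' := fun h => h ∘ Equiv.swap p q)
    ⟨fun h _ => hinv h, fun h _ => hinv h⟩
    (fun h hh => comp_swap_mem_Hset hpq hne hA₁ hA₂ hh) fun h hh => ?_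
  have := comp_swap_mem_Hset hpq (by simpa using hne.symm) (by simpa using hA₂)
    (by simpa using hA₁) hh
  rwa [hinv ii] at this

/-- well-definedness of the 2-move on `ℋ`: if positions `m, m+1`
(0-based) of `𝐢` carry distinct colors `i, j` with `a_{ij} = a_{ji} = 0`, and `𝐢′`
is obtained from `𝐢` by replacing the block `(i, j)` by `(j, i)`, then the map `T`
swapping coordinates `m` and `m + 1` restricts to a bijection from `ℋ_𝐢` onto `ℋ_𝐢′`. -/
theorem two_move_Hset
    (n N : ℕ) (hn : 1 ≤ n)
    (A : Fin n → Fin n → ℤ)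
    (hA2 : ∀ p, A p p = 2)
    (hAle : ∀ p q, p ≠ q → A p q ≤ 0)
    (hAzero : ∀ p q, A p q = 0 ↔ A q p = 0)
    (ii : Fin N → Fin n) (m : ℕ) (hm : m + 2 ≤ N)
    (i j : Fin n) (hij : i ≠ j)
    (hAij : A i j = 0) (hAji : A j i = 0)
    (h0 : ii ⟨m, by omega⟩ = i) (h1 : ii ⟨m + 1, by omega⟩ = j) :
    Set.BijOn
      (fun h : Fin N → ℤ => fun k : Fin N =>
        if (k : ℕ) = m then h ⟨m + 1, by omega⟩
        else if (k : ℕ) = m + 1 then h ⟨m, by omega⟩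
        else h k)
      (Hset A ii)
      (Hset A (fun k : Fin N =>
        if (k : ℕ) = m then j
        else if (k : ℕ) = m + 1 then i
        else ii k)) := by
  have hT : ∀ {α : Type} (f : Fin N → α), (fun k : Fin N =>
      if (k : ℕ) = m then f ⟨m + 1, by omega⟩
      else if (k : ℕ) = m + 1 then f ⟨m, by omega⟩
      else f k) = f ∘ Equiv.swap ⟨m, by omega⟩ ⟨m + 1, by omega⟩ := by
    intro α f
    funext k
    simp only [Function.comp_apply, Equiv.swap_apply_def, Fin.ext_iff]
    split_ifs <;> rfl
  have hbij := bijOn_comp_swap_Hset (A := A) (ii := ii) (p := ⟨m, by omega⟩)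
    (q := ⟨m + 1, by omega⟩) rfl (by rwa [h0, h1]) (by rwa [h0, h1]) (by rwa [h0, h1])
  simpa only [← hT, h0, h1] using hbij
end

section
/- (Well-definedness of the 3-move on ℋ.) Suppose 1 ≤ m and m + 2 ≤ N, with i_m = i_{m+2} = i, i_{m+1} = j, i ≠ j, and a_{ij} = a_{ji} = −1. Let 𝐢′ be the word obtained from 𝐢 by replacing the block (i_m, i_{m+1}, i_{m+2}) = (i, j, i) by (j, i, j), and let T : ℤ^N → ℤ^N be the map reversing the order of coordinates m, m + 1, m + 2 (so T(h)_{m+r} = h_{m+2−r} for r = 0, 1, 2) and fixing all other coordinates. Then T restricts to a bijection from ℋ_𝐢 onto ℋ_{𝐢′}. -/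
/-- The partial sum `Σ_{l < t} a_{p, j_l} x_l`. -/
def prefixSum {n N : ℕ} (A : Fin n → Fin n → ℤ) (ii : Fin N → Fin n) (x : Fin N → ℤ)
    (p : Fin n) (t : ℕ) : ℤ :=
  ∑ l ∈ Finset.univ.filter (fun l : Fin N => (l : ℕ) < t), A p (ii l) * x l

/-- The potential `x_k + Σ_{l < k} a_{j_k j_l} x_l`, whose increments along a color are the
values of `betaFn`. -/
def potential {n N : ℕ} (A : Fin n → Fin n → ℤ) (ii : Fin N → Fin n) (x : Fin N → ℤ)
    (k : Fin N) : ℤ :=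
  prefixSum A ii x (ii k) k + x k

section

variable {n N : ℕ} {A : Fin n → Fin n → ℤ} {ii jj : Fin N → Fin n} {x y : Fin N → ℤ}

lemma prefixSum_succ (p : Fin n) (k : Fin N) :
    prefixSum A ii x p (k + 1) = prefixSum A ii x p k + A p (ii k) * x k := by
  have hs : Finset.univ.filter (fun l : Fin N => (l : ℕ) < k + 1) =
      insert k (Finset.univ.filter (fun l : Fin N => (l : ℕ) < k)) := by
    ext l
    simp only [Finset.mem_filter, Finset.mem_univ, true_and, Finset.mem_insert, Fin.ext_iff]
    omega
  rw [prefixSum, hs, Finset.sum_insert (by simp), prefixSum, add_comm]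

lemma prefixSum_eq_add_between (p : Fin n) {k l : Fin N} (hkl : k < l) :
    prefixSum A ii x p l = prefixSum A ii x p (k + 1) +
      ∑ j ∈ Finset.univ.filter (fun j => k < j ∧ j < l), A p (ii j) * x j := by
  have hs : Finset.univ.filter (fun j : Fin N => (j : ℕ) < l) =
      Finset.univ.filter (fun j : Fin N => (j : ℕ) < k + 1) ∪
        Finset.univ.filter (fun j => k < j ∧ j < l) := by
    ext j
    simp only [Finset.mem_filter, Finset.mem_univ, true_and, Finset.mem_union, Fin.lt_def] at *
    omega
  rw [prefixSum, hs, Finset.sum_union, prefixSum]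
  rw [Finset.disjoint_left]
  intro j
  simp only [Finset.mem_filter, Finset.mem_univ, true_and, Fin.lt_def]
  omega

lemma betaFn_eq_potential_sub (hA2 : ∀ p, A p p = 2) {k l : Fin N} (hkl : k < l)
    (hc : ii l = ii k) : betaFn A ii x k l = potential A ii x l - potential A ii x k := by
  rw [potential, potential, hc, prefixSum_eq_add_between _ hkl, prefixSum_succ, hA2, betaFn]
  ring

lemma exists_isKPlus_le {k l : Fin N} (hkl : k < l) (hc : ii l = ii k) :
    ∃ l', IsKPlus ii k l' ∧ l' ≤ l := by
  obtain ⟨l', ⟨h1, h2⟩, hmin⟩ := WellFounded.has_min (wellFounded_lt (α := Fin N))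
    {j | k < j ∧ ii j = ii k} ⟨l, hkl, hc⟩
  exact ⟨l', ⟨h1, h2, fun j hj hj' => not_lt.1 (hmin j ⟨hj, hj'⟩)⟩,
    not_lt.1 (hmin l ⟨hkl, hc⟩)⟩

/-- `ℋ` consists of the vectors whose potential is constant on each color. -/
lemma mem_Hset_iff (hA2 : ∀ p, A p p = 2) :
    x ∈ Hset A ii ↔ ∀ k l, ii k = ii l → potential A ii x k = potential A ii x l := by
  constructor
  · intro h
    have key : ∀ l k : Fin N, k < l → ii l = ii k →
        potential A ii x k = potential A ii x l := by
      intro l k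
      induction k using WellFoundedGT.induction with
      | ind k ih =>
        intro hkl hc
        obtain ⟨l', hp, hle⟩ := exists_isKPlus_le hkl hc
        have hb := h k l' hp
        rw [betaFn_eq_potential_sub hA2 hp.1 hp.2.1, sub_eq_zero] at hb
        rw [← hb]
        rcases hle.eq_or_lt with rfl | hlt
        · rfl
        · exact ih l' hp.1 hlt (hc.trans hp.2.1.symm)
    intro k l hc
    rcases lt_trichotomy k l with hkl | rfl | hkl
    · exact key l k hkl hc.symm
    · rfl
    · exact (key k l hkl hc).symm
  · intro h k l hp
    rw [betaFn_eq_potential_sub hA2 hp.1 hp.2.1, h l k hp.2.1, sub_self]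

lemma prefixSum_congr_of_le {a : ℕ} (hw : ∀ k : Fin N, (k : ℕ) < a → jj k = ii k)
    (hx : ∀ k : Fin N, (k : ℕ) < a → y k = x k) (p : Fin n) {t : ℕ} (ht : t ≤ a) :
    prefixSum A jj y p t = prefixSum A ii x p t := by
  refine Finset.sum_congr rfl fun l hl => ?_
  have hl' : (l : ℕ) < a := (Finset.mem_filter.1 hl).2.trans_le ht
  rw [hw l hl', hx l hl']

lemma prefixSum_congr_of_ge {b : ℕ} (hw : ∀ k : Fin N, b ≤ (k : ℕ) → jj k = ii k)
    (hx : ∀ k : Fin N, b ≤ (k : ℕ) → y k = x k) (p : Fin n)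
    (hb : prefixSum A jj y p b = prefixSum A ii x p b) {t : ℕ} (hbt : b ≤ t) (ht : t ≤ N) :
    prefixSum A jj y p t = prefixSum A ii x p t := by
  induction t, hbt using Nat.le_induction with
  | base => exact hb
  | succ t hbt ih =>
    have hj := prefixSum_succ (A := A) (ii := jj) (x := y) p ⟨t, ht⟩
    have hi := prefixSum_succ (A := A) (ii := ii) (x := x) p ⟨t, ht⟩
    dsimp only at hj hi
    rw [hj, hi, ih (by omega), hw ⟨t, ht⟩ hbt, hx ⟨t, ht⟩ hbt]

lemma mem_Hset_of_three_move (hA2 : ∀ p, A p p = 2) {i j : Fin n}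
    (hAij : A i j = -1) (hAji : A j i = -1) {a b c : Fin N}
    (hb : (b : ℕ) = a + 1) (hc : (c : ℕ) = b + 1)
    (hia : ii a = i) (hib : ii b = j) (hic : ii c = i)
    (hja : jj a = j) (hjb : jj b = i) (hjc : jj c = j)
    (hw : ∀ k, k ≠ a → k ≠ b → k ≠ c → jj k = ii k)
    (hya : y a = x c) (hyb : y b = x b) (hyc : y c = x a)
    (hy : ∀ k, k ≠ a → k ≠ b → k ≠ c → y k = x k)
    (hx : x ∈ Hset A ii) : y ∈ Hset A jj := by
  rw [mem_Hset_iff hA2] at hx ⊢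
  have hlow : ∀ p {t : ℕ}, t ≤ a → prefixSum A jj y p t = prefixSum A ii x p t := by
    intro p t ht
    refine prefixSum_congr_of_le (a := a) (fun k hk => hw k ?_ ?_ ?_)
      (fun k hk => hy k ?_ ?_ ?_) p ht <;> rintro rfl <;> omega
  have sx : ∀ p, prefixSum A ii x p b = prefixSum A ii x p a + A p i * x a := by
    intro p; rw [hb, prefixSum_succ, hia]
  have sx' : ∀ p, prefixSum A ii x p c =
      prefixSum A ii x p a + A p i * x a + A p j * x b := by
    intro p; rw [hc, prefixSum_succ, hib, sx]
  have sy : ∀ p, prefixSum A jj y p b = prefixSum A ii x p a + A p j * x c := by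
    intro p; rw [hb, prefixSum_succ, hja, hya, hlow p le_rfl]
  have sy' : ∀ p, prefixSum A jj y p c =
      prefixSum A ii x p a + A p j * x c + A p i * x b := by
    intro p; rw [hc, prefixSum_succ, hjb, hyb, sy]
  have hrel : x b = x a + x c := by
    have h := hx a c (hia.trans hic.symm)
    rw [potential, potential, hia, hic, sx', hA2, hAij] at h
    linarith
  have hhigh : ∀ p (k : Fin N), c < k → prefixSum A jj y p k = prefixSum A ii x p k := by
    intro p k hk
    refine prefixSum_congr_of_ge (b := c + 1) (fun k hk => hw k ?_ ?_ ?_)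
      (fun k hk => hy k ?_ ?_ ?_) p ?_ hk k.2.le
    iterate 6 rintro rfl; omega
    rw [prefixSum_succ, prefixSum_succ, sy', sx', hjc, hic, hyc, hrel]
    ring
  have hpot : ∀ k, ∃ k', ii k' = jj k ∧ potential A jj y k = potential A ii x k' := by
    intro k
    by_cases hka : k = a
    · refine ⟨b, by rw [hka, hja, hib], ?_⟩
      rw [hka, potential, potential, hja, hib, hlow _ le_rfl, sx, hya, hAji, hrel]
      ring
    by_cases hkb : k = b
    · refine ⟨a, by rw [hkb, hjb, hia], ?_⟩
      rw [hkb, potential, potential, hjb, hia, sy, hyb, hAij, hrel]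
      ring
    by_cases hkc : k = c
    · refine ⟨b, by rw [hkc, hjc, hib], ?_⟩
      rw [hkc, potential, potential, hjc, hib, sy', sx, hyc, hAji, hA2, hrel]
      ring
    refine ⟨k, (hw k hka hkb hkc).symm, ?_⟩
    rw [potential, potential, hw k hka hkb hkc, hy k hka hkb hkc]
    rcases le_or_gt (k : ℕ) a with hk | hk
    · rw [hlow _ hk]
    · rw [hhigh]
      simp only [Fin.ext_iff, Fin.lt_def] at *
      omega
  intro k l hkl
  obtain ⟨k', hk', hk⟩ := hpot k
  obtain ⟨l', hl', hl⟩ := hpot l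
  rw [hk, hl]
  exact hx k' l' (by rw [hk', hl', hkl])

end

/-- well-definedness of the 3-move on `ℋ`: if positions `m, m+1, m+2`
(0-based) of `𝐢` carry the colors `i, j, i` with `i ≠ j` and `a_{ij} = a_{ji} = −1`,
and `𝐢′` is obtained from `𝐢` by replacing the block `(i, j, i)` by `(j, i, j)`, then
the map `T` reversing the coordinates `m, m+1, m+2` restricts to a bijection from
`ℋ_𝐢` onto `ℋ_𝐢′`. -/
theorem three_move_Hset
    (n N : ℕ) (hn : 1 ≤ n)
    (A : Fin n → Fin n → ℤ)
    (hA2 : ∀ p, A p p = 2)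
    (hAle : ∀ p q, p ≠ q → A p q ≤ 0)
    (hAzero : ∀ p q, A p q = 0 ↔ A q p = 0)
    (ii : Fin N → Fin n) (m : ℕ) (hm : m + 3 ≤ N)
    (i j : Fin n) (hij : i ≠ j)
    (hAij : A i j = -1) (hAji : A j i = -1)
    (h0 : ii ⟨m, by omega⟩ = i) (h1 : ii ⟨m + 1, by omega⟩ = j)
    (h2 : ii ⟨m + 2, by omega⟩ = i) :
    Set.BijOn
      (fun h : Fin N → ℤ => fun k : Fin N =>
        if (k : ℕ) = m then h ⟨m + 2, by omega⟩
        else if (k : ℕ) = m + 2 then h ⟨m, by omega⟩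
        else h k)
      (Hset A ii)
      (Hset A (fun k : Fin N =>
        if (k : ℕ) = m then j
        else if (k : ℕ) = m + 1 then i
        else if (k : ℕ) = m + 2 then j
        else ii k)) := by
  refine Set.InvOn.bijOn (f' := fun h : Fin N → ℤ => fun k : Fin N =>
        if (k : ℕ) = m then h ⟨m + 2, by omega⟩
        else if (k : ℕ) = m + 2 then h ⟨m, by omega⟩
        else h k) ?_ ?_ ?_
  · constructor <;>
    · intro h _
      funext k
      by_cases hk : (k : ℕ) = m
      · simp [← hk]
      · by_cases hk' : (k : ℕ) = m + 2
        · simp +contextual [← hk']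
        · simp [hk, hk']
  · intro h hh
    refine mem_Hset_of_three_move hA2 hAij hAji (a := ⟨m, by omega⟩) (b := ⟨m + 1, by omega⟩)
      (c := ⟨m + 2, by omega⟩) rfl rfl h0 h1 h2 ?_ ?_ ?_ ?_ ?_ ?_ ?_ ?_ hh <;>
    simp +contextual [Fin.ext_iff]
  · intro h hh
    refine mem_Hset_of_three_move hA2 hAji hAij (a := ⟨m, by omega⟩) (b := ⟨m + 1, by omega⟩)
      (c := ⟨m + 2, by omega⟩) rfl rfl ?_ ?_ ?_ h0 h1 h2 ?_ ?_ ?_ ?_ ?_ hh <;>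
    simp +contextual [Fin.ext_iff]
end

section
/- (Well-definedness of the 6-move on ℋ.) Suppose 1 ≤ m and m + 5 ≤ N, with i_m = i_{m+2} = i_{m+4} = i, i_{m+1} = i_{m+3} = i_{m+5} = j, i ≠ j, and a_{ij}·a_{ji} = 3. Let 𝐢′ be the word obtained from 𝐢 by replacing the block (i, j, i, j, i, j) in positions m,…,m + 5 by (j, i, j, i, j, i), and let T : ℤ^N → ℤ^N be the map reversing the order of coordinates m,…,m + 5 (so T(h)_{m+r} = h_{m+5−r} for r = 0,…,5) and fixing all other coordinates. Then T restricts to a bijection from ℋ_𝐢 onto ℋ_{𝐢′}. -/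
theorem IsKPlus.unique {n N : ℕ} {w : Fin N → Fin n} {k l l' : Fin N}
    (h : IsKPlus w k l) (h' : IsKPlus w k l') : l = l' :=
  le_antisymm (h.2.2 l' h'.1 h'.2.1) (h'.2.2 l h.1 h.2.1)

theorem sum_filter_between_split {N : ℕ} (f : Fin N → ℤ) {k p l : Fin N} (hkp : k < p)
    (hpl : p < l) :
    ∑ t ∈ Finset.univ.filter (fun t => k < t ∧ t < l), f t =
      ∑ t ∈ Finset.univ.filter (fun t => k < t ∧ t < p), f t + f p +
        ∑ t ∈ Finset.univ.filter (fun t => p < t ∧ t < l), f t := by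
  have h : Finset.univ.filter (fun t => k < t ∧ t < l) =
      (insert p (Finset.univ.filter (fun t => k < t ∧ t < p))) ∪
        Finset.univ.filter (fun t => p < t ∧ t < l) := by
    ext t
    simp only [Finset.mem_filter, Finset.mem_univ, true_and, Finset.mem_union, Finset.mem_insert]
    omega
  rw [h, Finset.sum_union, Finset.sum_insert (by simp), add_comm (f p)]
  rw [Finset.disjoint_left]
  intro t
  simp only [Finset.mem_filter, Finset.mem_univ, true_and, Finset.mem_insert]
  omega

theorem sum_filter_between_succ {N : ℕ} (f : Fin N → ℤ) {k l : Fin N}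
    (h : (l : ℕ) = k + 1) :
    ∑ t ∈ Finset.univ.filter (fun t => k < t ∧ t < l), f t = 0 := by
  apply Finset.sum_eq_zero
  intro t
  simp only [Finset.mem_filter, Finset.mem_univ, true_and]
  omega

theorem sum_filter_between_congr {N : ℕ} {f g : Fin N → ℤ} {k l : Fin N}
    (h : ∀ t, k < t → t < l → f t = g t) :
    ∑ t ∈ Finset.univ.filter (fun t => k < t ∧ t < l), f t =
      ∑ t ∈ Finset.univ.filter (fun t => k < t ∧ t < l), g t := by
  apply Finset.sum_congr rfl
  intro t
  simp only [Finset.mem_filter, Finset.mem_univ, true_and]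
  exact fun ht => h t ht.1 ht.2

theorem isKPlus_of_alternating {n N : ℕ} {w : Fin N → Fin n} {k p l : Fin N}
    (hp : (p : ℕ) = k + 1) (hl : (l : ℕ) = p + 1) (hwp : w p ≠ w k) (hwl : w l = w k) :
    IsKPlus w k l := by
  refine ⟨by omega, hwl, fun t ht hwt => ?_⟩
  have : t ≠ p := by rintro rfl; exact hwp hwt
  omega

theorem betaFn_of_consecutive {n N : ℕ} (A : Fin n → Fin n → ℤ) (w : Fin N → Fin n)
    (x : Fin N → ℤ) {k p l : Fin N} (hp : (p : ℕ) = k + 1) (hl : (l : ℕ) = p + 1) :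
    betaFn A w x k l = x k + A (w k) (w p) * x p + x l := by
  rw [betaFn, sum_filter_between_split _ (p := p) (by omega) (by omega),
    sum_filter_between_succ _ hp, sum_filter_between_succ _ hl]
  ring

/-- Reversing six consecutive alternating coordinates carries `ℋ` of a word into `ℋ` of the word
with the two alternating colors of that block exchanged. -/
theorem mem_Hset_of_reverse_block {n N : ℕ} (A : Fin n → Fin n → ℤ) {w w' : Fin N → Fin n}
    {x y : Fin N → ℤ} {i j : Fin n} (hij : i ≠ j) (hA : A i j * A j i = 3)
    {p0 p1 p2 p3 p4 p5 : Fin N}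
    (hp1 : (p1 : ℕ) = p0 + 1) (hp2 : (p2 : ℕ) = p1 + 1) (hp3 : (p3 : ℕ) = p2 + 1)
    (hp4 : (p4 : ℕ) = p3 + 1) (hp5 : (p5 : ℕ) = p4 + 1)
    (w0 : w p0 = i) (w1 : w p1 = j) (w2 : w p2 = i) (w3 : w p3 = j) (w4 : w p4 = i)
    (w5 : w p5 = j)
    (v0 : w' p0 = j) (v1 : w' p1 = i) (v2 : w' p2 = j) (v3 : w' p3 = i) (v4 : w' p4 = j)
    (v5 : w' p5 = i)
    (y0 : y p0 = x p5) (y1 : y p1 = x p4) (y2 : y p2 = x p3) (y3 : y p3 = x p2)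
    (y4 : y p4 = x p1) (y5 : y p5 = x p0)
    (hw : ∀ t, t < p0 ∨ p5 < t → w' t = w t) (hy : ∀ t, t < p0 ∨ p5 < t → y t = x t)
    (hx : x ∈ Hset A w) : y ∈ Hset A w' := by
  have r0 := hx p0 p2 (isKPlus_of_alternating hp1 hp2 (by grind) (by grind))
  have r1 := hx p1 p3 (isKPlus_of_alternating hp2 hp3 (by grind) (by grind))
  have r2 := hx p2 p4 (isKPlus_of_alternating hp3 hp4 (by grind) (by grind))
  have r3 := hx p3 p5 (isKPlus_of_alternating hp4 hp5 (by grind) (by grind))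
  rw [betaFn_of_consecutive A w x hp1 hp2, w0, w1] at r0
  rw [betaFn_of_consecutive A w x hp2 hp3, w1, w2] at r1
  rw [betaFn_of_consecutive A w x hp3 hp4, w2, w3] at r2
  rw [betaFn_of_consecutive A w x hp4 hp5, w3, w4] at r3
  have e4 : x p4 = -A i j * x p1 - 2 * x p0 := by
    linear_combination r2 - A i j * r1 + (-1 + A i j * A j i) * r0 +
      (-x p0 - A i j * x p1) * hA
  have e5 : x p5 = x p1 + A j i * x p0 := by
    linear_combination r3 - A j i * e4 - r1 + A j i * r0
  have e0 : A i j * x p5 + x p4 = x p0 := by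
    linear_combination A i j * e5 + e4 + x p0 * hA
  have hcases : ∀ t : Fin N, t = p0 ∨ t = p1 ∨ t = p2 ∨ t = p3 ∨ t = p4 ∨ t = p5 ∨
      (t < p0 ∨ p5 < t) := by
    intro t
    omega
  have hsum : ∀ (c : Fin n) (k l : Fin N), l ≤ p0 ∨ p5 ≤ k →
      ∑ t ∈ Finset.univ.filter (fun t => k < t ∧ t < l), A c (w' t) * y t =
        ∑ t ∈ Finset.univ.filter (fun t => k < t ∧ t < l), A c (w t) * x t := by
    intro c k l hkl
    refine sum_filter_between_congr fun t ht ht' => ?_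
    have ho : t < p0 ∨ p5 < t := by omega
    rw [hw t ho, hy t ho]
  intro k l hkl
  rcases hcases k with rfl | rfl | rfl | rfl | rfl | rfl | hk
  · rw [hkl.unique (isKPlus_of_alternating hp1 hp2 (by grind) (by grind)),
      betaFn_of_consecutive A w' y hp1 hp2, v0, v1, y0, y1, y2]
    linear_combination r3
  · rw [hkl.unique (isKPlus_of_alternating hp2 hp3 (by grind) (by grind)),
      betaFn_of_consecutive A w' y hp2 hp3, v1, v2, y1, y2, y3]
    linear_combination r2
  · rw [hkl.unique (isKPlus_of_alternating hp3 hp4 (by grind) (by grind)),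
      betaFn_of_consecutive A w' y hp3 hp4, v2, v3, y2, y3, y4]
    linear_combination r1
  · rw [hkl.unique (isKPlus_of_alternating hp4 hp5 (by grind) (by grind)),
      betaFn_of_consecutive A w' y hp4 hp5, v3, v4, y3, y4, y5]
    linear_combination r0
  · obtain ⟨hlt, hl, hmin⟩ := hkl
    have hl5 : p5 < l := by
      have : l ≠ p5 := by grind
      omega
    have hlw : IsKPlus w p5 l := by
      refine ⟨hl5, by grind, fun t ht hwt => hmin t (by omega) ?_⟩
      grind
    have hb := hx p5 l hlw
    rw [betaFn, w5] at hb
    rw [betaFn, v4, sum_filter_between_split _ (p := p5) (by omega) hl5,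
      sum_filter_between_succ _ hp5, hsum j p5 l (by omega), v5, y5, y4, hy l (by omega)]
    linear_combination hb - e5
  · obtain ⟨hl5, hl, hmin⟩ := hkl
    have hlw : IsKPlus w p4 l := by
      refine ⟨by omega, by grind, fun t ht hwt => ?_⟩
      have : t ≠ k := by grind
      exact hmin t (by omega) (by grind)
    have hb := hx p4 l hlw
    rw [betaFn, w4, sum_filter_between_split _ (p := k) (by omega) hl5,
      sum_filter_between_succ _ hp5, w5] at hb
    rw [betaFn, v5, hsum i k l (by omega), y5, hy l (by omega)]
    linear_combination hb - e0
  · obtain ⟨hlt, hl, hmin⟩ := hkl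
    rw [betaFn, hw k hk, hy k hk]
    rw [hw k hk] at hl hmin
    rcases hcases l with rfl | rfl | rfl | rfl | rfl | rfl | hl'
    · have hlw : IsKPlus w k p1 := by
        refine ⟨by omega, by grind, fun t ht hwt => ?_⟩
        by_contra hlt'
        have : t ≠ l := by grind
        have := hmin t ht (by grind)
        omega
      have hb := hx k p1 hlw
      rw [betaFn, sum_filter_between_split _ (p := l) (by omega) (by omega),
        sum_filter_between_succ _ hp1, w0, ← hl, v0] at hb
      rw [← hl, v0, hsum j k l (by omega), y0]
      linear_combination hb + e5
    · have hlw : IsKPlus w k p0 := by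
        refine ⟨by omega, by grind, fun t ht hwt => ?_⟩
        by_contra hlt'
        have := hmin t ht (by grind)
        omega
      have hb := hx k p0 hlw
      rw [betaFn, ← hl, v1] at hb
      rw [← hl, v1, sum_filter_between_split _ (p := p0) (by omega) (by omega),
        sum_filter_between_succ _ hp1, hsum i k p0 (by omega), v0, y0, y1]
      linear_combination hb + e0
    · have := hmin p0 (by omega) (by grind)
      omega
    · have := hmin p1 (by omega) (by grind)
      omega
    · have := hmin p0 (by omega) (by grind)
      omega
    · have := hmin p1 (by omega) (by grind)
      omega
    · rw [hy l hl']
      by_cases hside : l < p0 ∨ p5 < k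
      · rw [hsum (w k) k l (by omega)]
        refine hx k l ⟨hlt, by grind, fun t ht hwt => ?_⟩
        by_contra hlt'
        have := hmin t ht (by rw [hw t (by omega), hwt])
        omega
      · have hki : w k ≠ i := by
          intro h
          have := hmin p1 (by omega) (by grind)
          omega
        have hkj : w k ≠ j := by
          intro h
          have := hmin p0 (by omega) (by grind)
          omega
        have hb := hx k l ⟨hlt, by grind, fun t ht hwt => hmin t ht (by grind)⟩
        have split : ∀ f : Fin N → ℤ,
            ∑ t ∈ Finset.univ.filter (fun t => k < t ∧ t < l), f t =
              ∑ t ∈ Finset.univ.filter (fun t => k < t ∧ t < p0), f t + f p0 + f p1 + f p2 +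
                f p3 + f p4 + f p5 +
                ∑ t ∈ Finset.univ.filter (fun t => p5 < t ∧ t < l), f t := by
          intro f
          rw [sum_filter_between_split f (k := k) (p := p0) (l := l) (by omega) (by omega),
            sum_filter_between_split f (k := p0) (p := p1) (l := l) (by omega) (by omega),
            sum_filter_between_split f (k := p1) (p := p2) (l := l) (by omega) (by omega),
            sum_filter_between_split f (k := p2) (p := p3) (l := l) (by omega) (by omega),
            sum_filter_between_split f (k := p3) (p := p4) (l := l) (by omega) (by omega),
            sum_filter_between_split f (k := p4) (p := p5) (l := l) (by omega) (by omega),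
            sum_filter_between_succ f hp1, sum_filter_between_succ f hp2,
            sum_filter_between_succ f hp3, sum_filter_between_succ f hp4,
            sum_filter_between_succ f hp5]
          ring
        rw [betaFn, split, w0, w1, w2, w3, w4, w5] at hb
        rw [split, hsum (w k) k p0 (by omega), hsum (w k) p5 l (by omega), v0, v1, v2, v3, v4,
          v5, y0, y1, y2, y3, y4, y5]
        linear_combination hb

/-- well-definedness of the 6-move on `ℋ`: if positions `m,…,m+5`
(0-based) of `𝐢` carry the colors `i, j, i, j, i, j` with `i ≠ j` and
`a_{ij}·a_{ji} = 3`, and `𝐢′` is obtained from `𝐢` by replacing the block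
`(i, j, i, j, i, j)` by `(j, i, j, i, j, i)`, then the map `T` reversing the
coordinates `m,…,m+5` restricts to a bijection from `ℋ_𝐢` onto `ℋ_𝐢′`. -/
theorem six_move_Hset
    (n N : ℕ) (hn : 1 ≤ n)
    (A : Fin n → Fin n → ℤ)
    (hA2 : ∀ p, A p p = 2)
    (hAle : ∀ p q, p ≠ q → A p q ≤ 0)
    (hAzero : ∀ p q, A p q = 0 ↔ A q p = 0)
    (ii : Fin N → Fin n) (m : ℕ) (hm : m + 6 ≤ N)
    (i j : Fin n) (hij : i ≠ j)
    (hAij : A i j * A j i = 3)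
    (h0 : ii ⟨m, by omega⟩ = i) (h1 : ii ⟨m + 1, by omega⟩ = j)
    (h2 : ii ⟨m + 2, by omega⟩ = i) (h3 : ii ⟨m + 3, by omega⟩ = j)
    (h4 : ii ⟨m + 4, by omega⟩ = i) (h5 : ii ⟨m + 5, by omega⟩ = j) :
    Set.BijOn
      (fun h : Fin N → ℤ => fun k : Fin N =>
        if (k : ℕ) = m then h ⟨m + 5, by omega⟩
        else if (k : ℕ) = m + 1 then h ⟨m + 4, by omega⟩
        else if (k : ℕ) = m + 2 then h ⟨m + 3, by omega⟩
        else if (k : ℕ) = m + 3 then h ⟨m + 2, by omega⟩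
        else if (k : ℕ) = m + 4 then h ⟨m + 1, by omega⟩
        else if (k : ℕ) = m + 5 then h ⟨m, by omega⟩
        else h k)
      (Hset A ii)
      (Hset A (fun k : Fin N =>
        if (k : ℕ) = m then j
        else if (k : ℕ) = m + 1 then i
        else if (k : ℕ) = m + 2 then j
        else if (k : ℕ) = m + 3 then i
        else if (k : ℕ) = m + 4 then j
        else if (k : ℕ) = m + 5 then i
        else ii k)) := by
  refine ⟨?_, ?_, ?_⟩
  · intro x hx
    refine mem_Hset_of_reverse_block A hij hAij (p0 := ⟨m, by omega⟩) (p1 := ⟨m + 1, by omega⟩)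
      (p2 := ⟨m + 2, by omega⟩) (p3 := ⟨m + 3, by omega⟩) (p4 := ⟨m + 4, by omega⟩)
      (p5 := ⟨m + 5, by omega⟩) rfl rfl rfl rfl rfl h0 h1 h2 h3 h4 h5
      (by simp) (by simp) (by simp) (by simp) (by simp) (by simp)
      (by simp) (by simp) (by simp) (by simp) (by simp) (by simp) ?_ ?_ hx <;>
    · intro t ht
      simp only [Fin.lt_def] at ht
      grind
  · intro x _ y _ hxy
    have hval : ∀ t : Fin N, _ := fun t => congrFun hxy t
    have e0 := hval ⟨m, by omega⟩
    have e1 := hval ⟨m + 1, by omega⟩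
    have e2 := hval ⟨m + 2, by omega⟩
    have e3 := hval ⟨m + 3, by omega⟩
    have e4 := hval ⟨m + 4, by omega⟩
    have e5 := hval ⟨m + 5, by omega⟩
    simp at e0 e1 e2 e3 e4 e5
    ext t
    have et := hval t
    grind
  · intro y hy
    refine ⟨fun k : Fin N =>
        if (k : ℕ) = m then y ⟨m + 5, by omega⟩
        else if (k : ℕ) = m + 1 then y ⟨m + 4, by omega⟩
        else if (k : ℕ) = m + 2 then y ⟨m + 3, by omega⟩
        else if (k : ℕ) = m + 3 then y ⟨m + 2, by omega⟩
        else if (k : ℕ) = m + 4 then y ⟨m + 1, by omega⟩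
        else if (k : ℕ) = m + 5 then y ⟨m, by omega⟩
        else y k, ?_, ?_⟩
    · refine mem_Hset_of_reverse_block A hij.symm (by rw [mul_comm, hAij])
        (p0 := ⟨m, by omega⟩) (p1 := ⟨m + 1, by omega⟩)
        (p2 := ⟨m + 2, by omega⟩) (p3 := ⟨m + 3, by omega⟩) (p4 := ⟨m + 4, by omega⟩)
        (p5 := ⟨m + 5, by omega⟩) rfl rfl rfl rfl rfl
        (by simp) (by simp) (by simp) (by simp) (by simp) (by simp) h0 h1 h2 h3 h4 h5
        (by simp) (by simp) (by simp) (by simp) (by simp) (by simp) ?_ ?_ hy <;>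
      · intro t ht
        simp only [Fin.lt_def] at ht
        grind
    · ext t
      grind
end

section
/- (Telescoping identity ⟨h_i, s_{i_1}⋯s_{i_N}Λ⟩ = −ε_i(𝐡_Λ), from the proof of the isomorphism theorem.) Suppose i ∈ I occurs in the word 𝐢 and let k₁ be the least index with i_{k₁} = i. Then c^{(1)}_i = −m_{k₁} − Σ_{j<k₁} a_{i i_j} m_j. -/
/-- The simple reflection `s_p` acting on the coordinate vector `c ∈ ℤ^n` of an
integral weight (`c_q = ⟨h_q, λ⟩`): `(s_p(c))_q = c_q − a_{qp} c_p`. -/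
def sref {n : ℕ} (A : Fin n → Fin n → ℤ) (p : Fin n) (c : Fin n → ℤ) : Fin n → ℤ :=
  fun q => c q - A q p * c p

/-- `wtChain A ii Λ t` is the coordinate vector `c^{(N+1-t)}` representing
`s_{i_{N-t+1}} s_{i_{N-t+2}} ⋯ s_{i_N} Λ`; so `wtChain A ii Λ 0 = Λ` and
`wtChain A ii Λ N` represents `c^{(1)} = s_{i_1} ⋯ s_{i_N} Λ`. -/
def wtChain {n N : ℕ} (A : Fin n → Fin n → ℤ) (ii : Fin N → Fin n)
    (Λ : Fin n → ℤ) : ℕ → (Fin n → ℤ)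
  | 0 => Λ
  | t + 1 =>
    if h : t < N then sref A (ii ⟨N - 1 - t, by omega⟩) (wtChain A ii Λ t)
    else wtChain A ii Λ t

theorem wtChain_sub_val {n N : ℕ} (A : Fin n → Fin n → ℤ) (ii : Fin N → Fin n)
    (Λ : Fin n → ℤ) (k : Fin N) :
    wtChain A ii Λ (N - k) = sref A (ii k) (wtChain A ii Λ (N - 1 - k)) := by
  have hk := k.isLt
  have hidx : (⟨N - 1 - (N - 1 - (k : ℕ)), by omega⟩ : Fin N) = k := Fin.ext (by simp; omega)
  rw [show N - (k : ℕ) = (N - 1 - k) + 1 by omega, wtChain, dif_pos (by omega), hidx]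

theorem wtChain_apply_eq_sub_sum {n N : ℕ} (A : Fin n → Fin n → ℤ) (ii : Fin N → Fin n)
    (Λ : Fin n → ℤ) (q : Fin n) (k : ℕ) (hk : k ≤ N) :
    wtChain A ii Λ N q
      = wtChain A ii Λ (N - k) q
        - ∑ j ∈ Finset.univ.filter (fun j : Fin N => (j : ℕ) < k),
            A q (ii j) * wtChain A ii Λ (N - 1 - (j : ℕ)) (ii j) := by
  induction k with
  | zero => simp
  | succ k ih =>
    have hstep : wtChain A ii Λ (N - k) q = _ := congrFun (wtChain_sub_val A ii Λ ⟨k, hk⟩) q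
    have hfilter : Finset.univ.filter (fun j : Fin N => (j : ℕ) < k + 1)
        = insert ⟨k, hk⟩ (Finset.univ.filter (fun j : Fin N => (j : ℕ) < k)) := by
      ext j
      simp only [Finset.mem_filter_univ, Finset.mem_insert, Fin.ext_iff]
      omega
    rw [ih (by omega), hstep, hfilter, Finset.sum_insert (by simp),
      show N - (k + 1) = N - 1 - k by omega, sref]
    ring

/-- telescoping identity `⟨h_i, s_{i_1}⋯s_{i_N}Λ⟩ = −ε_i(𝐡_Λ)`: if `i`
occurs in `𝐢` with least occurrence index `k₁`, then
`c^{(1)}_i = −m_{k₁} − Σ_{j<k₁} a_{i i_j} m_j`, where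
`m_k = c^{(k+1)}_{i_k} = ⟨h_{i_k}, s_{i_{k+1}} ⋯ s_{i_N} Λ⟩` (0-based:
`m k = wtChain A ii Λ (N − 1 − k) (ii k)`). -/
theorem wtChain_eq_neg_eps
    (n N : ℕ) (hn : 1 ≤ n) (hN : 1 ≤ N)
    (A : Fin n → Fin n → ℤ)
    (hA2 : ∀ p, A p p = 2)
    (hAle : ∀ p q, p ≠ q → A p q ≤ 0)
    (hAzero : ∀ p q, A p q = 0 ↔ A q p = 0)
    (ii : Fin N → Fin n) (Λ : Fin n → ℤ) (i : Fin n)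
    (k1 : Fin N) (hk1 : ii k1 = i) (hk1min : ∀ j : Fin N, ii j = i → k1 ≤ j) :
    wtChain A ii Λ N i
      = -(wtChain A ii Λ (N - 1 - (k1 : ℕ)) (ii k1))
        - ∑ j ∈ Finset.univ.filter (fun j => j < k1),
            A i (ii j) * wtChain A ii Λ (N - 1 - (j : ℕ)) (ii j) := by
  have hstep := congrFun (wtChain_sub_val A ii Λ k1) i
  rw [sref, hk1, hA2] at hstep
  rw [wtChain_apply_eq_sub_sum A ii Λ i k1 k1.isLt.le, hstep, hk1]
  simp only [Fin.lt_def]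
  ring
end
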